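/- Let s ≥ 1 and ψ ∈ H^{s+1}(Ω). Define the midpoint quadrature error r₁ = τ F_{τ/2}(ψ) − ∫₀^τ F_θ(ψ) dθ for τ > 0. Then r₁ admits the second-order Peano representation r₁ = −τ³ ∫₀¹ κ₂(θ) ∂²_ω F_ω(ψ)|_{ω=θτ} dθ with κ₂(θ) = (1/2) min{θ², (1−θ)²}, and consequently ‖r₁‖_s ≤ C τ³ ‖ψ‖_{s+1}^{p+1} for a constant C > 0 depending only on s, p and Ω. -/

import Mathlib

/- Periodic functions on Ω = (a,b) are represented by their Fourier coefficient
sequences `c : ℤ → ℂ`, i.e. `z(x) = ∑_{l∈ℤ} c l * exp(i μ_l (x−a))` with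
`μ_l = 2πl/(b−a)`.  All operators are expressed on the Fourier side:
`⟨∇⟩`, `⟨∇⟩⁻¹`, `e^{it⟨∇⟩}` act diagonally, complex conjugation of the function
corresponds to `l ↦ conj (c (−l))`, and the pointwise product of two functions
corresponds to the convolution of their coefficient sequences. -/

noncomputable section

namespace NKGE

/-- Fourier frequency `μ_l = 2πl/(b−a)`. -/
def mu (a b : ℝ) (l : ℤ) : ℝ := 2 * Real.pi * l / (b - a)

/-- `ζ_l = √(1+μ_l²)`, the Fourier symbol of `⟨∇⟩ = √(1−∂_xx)`. -/
def zeta (a b : ℝ) (l : ℤ) : ℝ := Real.sqrt (1 + mu a b l ^ 2)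

/-- Squared `H^s`-norm: `‖z‖_s² = ∑_l (1+μ_l²)^s |ẑ_l|²`. -/
def sobNormSq (a b s : ℝ) (c : ℤ → ℂ) : ℝ := ∑' l : ℤ, (1 + mu a b l ^ 2) ^ s * ‖c l‖ ^ 2

/-- The `H^s`-norm `‖z‖_s`. -/
def sobNorm (a b s : ℝ) (c : ℤ → ℂ) : ℝ := Real.sqrt (sobNormSq a b s c)

/-- Membership in `H^s(Ω)`. -/
def MemHs (a b s : ℝ) (c : ℤ → ℂ) : Prop :=
  Summable fun l : ℤ => (1 + mu a b l ^ 2) ^ s * ‖c l‖ ^ 2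

/-- The operator `⟨∇⟩` acting in Fourier space. -/
def opJ (a b : ℝ) (c : ℤ → ℂ) : ℤ → ℂ := fun l => (zeta a b l : ℂ) * c l

/-- The operator `⟨∇⟩⁻¹` acting in Fourier space. -/
def opJinv (a b : ℝ) (c : ℤ → ℂ) : ℤ → ℂ := fun l => c l / (zeta a b l : ℂ)

/-- The operator `e^{it⟨∇⟩}` acting in Fourier space. -/
def expJ (a b t : ℝ) (c : ℤ → ℂ) : ℤ → ℂ :=
  fun l => Complex.exp (Complex.I * (t : ℂ) * (zeta a b l : ℂ)) * c l

/-- Fourier coefficients of the complex conjugate function `z̄`. -/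
def conjC (c : ℤ → ℂ) : ℤ → ℂ := fun l => (starRingEnd ℂ) (c (-l))

/-- Convolution of coefficient sequences = coefficients of the pointwise product. -/
def convC (c d : ℤ → ℂ) : ℤ → ℂ := fun l => ∑' m : ℤ, c m * d (l - m)

/-- Coefficients of the constant function `1`. -/
def oneC : ℤ → ℂ := fun l => if l = 0 then 1 else 0

/-- Coefficients of the `n`-th pointwise power `z^n`. -/
def powC (c : ℤ → ℂ) : ℕ → ℤ → ℂ
  | 0 => oneC
  | n + 1 => convC c (powC c n)

/-- Coefficients of `(ψ + ψ̄)/2`. -/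
def reC (c : ℤ → ℂ) : ℤ → ℂ := fun l => (c l + conjC c l) / 2

/-- Coefficients of `φ + φ̄`. -/
def addConj (c : ℤ → ℂ) : ℤ → ℂ := fun l => c l + conjC c l

/-- `G(φ) = f((φ+φ̄)/2)` with `f(v) = v^{p+1}`. -/
def Gop (p : ℕ) (c : ℤ → ℂ) : ℤ → ℂ := powC (reC c) (p + 1)

/-- `F(φ) = i ⟨∇⟩⁻¹ G(φ)`. -/
def Fop (a b : ℝ) (p : ℕ) (c : ℤ → ℂ) : ℤ → ℂ := fun l => Complex.I * opJinv a b (Gop p c) l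

/-- `F_t(φ) = e^{−it⟨∇⟩} F(e^{it⟨∇⟩} φ)`. -/
def Ft (a b : ℝ) (p : ℕ) (t : ℝ) (c : ℤ → ℂ) : ℤ → ℂ :=
  expJ a b (-t) (Fop a b p (expJ a b t c))

/-- `F'(φ)(η) = ((p+1)i/2^{p+1}) ⟨∇⟩⁻¹((φ+φ̄)^p (η+η̄))`. -/
def Fd (a b : ℝ) (p : ℕ) (φ η : ℤ → ℂ) : ℤ → ℂ :=
  fun l => ((p : ℂ) + 1) * Complex.I / 2 ^ (p + 1) *
    opJinv a b (convC (powC (addConj φ) p) (addConj η)) l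

/-- `F_t'(φ)(η) = e^{−it⟨∇⟩} F'(e^{it⟨∇⟩}φ)(e^{it⟨∇⟩}η)`. -/
def Ftd (a b : ℝ) (p : ℕ) (t : ℝ) (φ η : ℤ → ℂ) : ℤ → ℂ :=
  expJ a b (-t) (Fd a b p (expJ a b t φ) (expJ a b t η))

/-- `F''(φ)(η,ζ) = (p(p+1)i/2^{p+1}) ⟨∇⟩⁻¹((φ+φ̄)^{p−1}(η+η̄)(ζ+ζ̄))`. -/
def Fdd (a b : ℝ) (p : ℕ) (φ η ζ : ℤ → ℂ) : ℤ → ℂ :=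
  fun l => (p : ℂ) * ((p : ℂ) + 1) * Complex.I / 2 ^ (p + 1) *
    opJinv a b (convC (convC (powC (addConj φ) (p - 1)) (addConj η)) (addConj ζ)) l

/-- `F_t''(φ)(η,ζ) = e^{−it⟨∇⟩} F''(e^{it⟨∇⟩}φ)(e^{it⟨∇⟩}η, e^{it⟨∇⟩}ζ)`. -/
def Ftdd (a b : ℝ) (p : ℕ) (t : ℝ) (φ η ζ : ℤ → ℂ) : ℤ → ℂ :=
  expJ a b (-t) (Fdd a b p (expJ a b t φ) (expJ a b t η) (expJ a b t ζ))

/-- The flow `φ_V^t(ψ₀) = ψ₀ + ε^p t F(ψ₀)` of the nonlinear subproblem. -/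
def flowV (a b : ℝ) (p : ℕ) (ε t : ℝ) (c : ℤ → ℂ) : ℤ → ℂ :=
  fun l => c l + (ε ^ p * t) • Fop a b p c l

/-- The Strang splitting operator `S_τ = φ_T^{τ/2} ∘ φ_V^{τ} ∘ φ_T^{τ/2}`. -/
def strang (a b : ℝ) (p : ℕ) (ε τ : ℝ) (c : ℤ → ℂ) : ℤ → ℂ :=
  expJ a b (τ / 2) (flowV a b p ε τ (expJ a b (τ / 2) c))

/-- The alternative Strang splitting `S̃_τ = φ_V^{τ/2} ∘ φ_T^{τ} ∘ φ_V^{τ/2}`. -/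
def strang2 (a b : ℝ) (p : ℕ) (ε τ : ℝ) (c : ℤ → ℂ) : ℤ → ℂ :=
  flowV a b p ε (τ / 2) (expJ a b τ (flowV a b p ε (τ / 2) c))

/-- `Ψ` is an exact solution of the relativistic NLSE
`i∂_tψ + ⟨∇⟩ψ + ε^p ⟨∇⟩⁻¹ G(ψ) = 0`, written on the Fourier side, i.e.
`ψ' = i(ζ_l ψ_l + ε^p ζ_l⁻¹ (G(ψ))_l)`. -/
def IsExactSol (a b : ℝ) (p : ℕ) (ε : ℝ) (Ψ : ℝ → ℤ → ℂ) : Prop :=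
  ∀ (t : ℝ) (l : ℤ), HasDerivAt (fun s => Ψ s l)
    (Complex.I * ((zeta a b l : ℂ) * Ψ t l + (ε ^ p : ℂ) * Gop p (Ψ t) l / (zeta a b l : ℂ))) t

/-- Pointwise-in-`t` derivative `∂_t F_t(φ)`. -/
def dFt (a b : ℝ) (p : ℕ) (t : ℝ) (c : ℤ → ℂ) : ℤ → ℂ :=
  fun l => deriv (fun τ => Ft a b p τ c l) t

/-- Second derivative `∂_t² F_t(φ)`. -/
def d2Ft (a b : ℝ) (p : ℕ) (t : ℝ) (c : ℤ → ℂ) : ℤ → ℂ :=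
  fun l => deriv (fun τ => dFt a b p τ c l) t

/-- Derivative `∂_t F_t'(φ)(η)`. -/
def dFtd (a b : ℝ) (p : ℕ) (t : ℝ) (φ η : ℤ → ℂ) : ℤ → ℂ :=
  fun l => deriv (fun τ => Ftd a b p τ φ η l) t



open scoped ENNReal

/-- convolution in `ℝ≥0∞` -/
def cv (X Y : ℤ → ℝ≥0∞) : ℤ → ℝ≥0∞ := fun l => ∑' m : ℤ, X m * Y (l - m)

/-- extended weight -/
def zz (a b : ℝ) (l : ℤ) : ℝ≥0∞ := ENNReal.ofReal (zeta a b l)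

/-- extended squared Sobolev norm -/
def QQ (a b σ : ℝ) (X : ℤ → ℝ≥0∞) : ℝ≥0∞ := ∑' l : ℤ, (zz a b l ^ σ * X l) ^ 2

lemma cv_comm (X Y : ℤ → ℝ≥0∞) : cv X Y = cv Y X := by
  funext l
  unfold cv
  rw [← (Equiv.subLeft l).tsum_eq]
  apply tsum_congr
  intro m
  simp [mul_comm]

lemma mul_le_sq_add (x y : ℝ≥0∞) : x * y ≤ x ^ 2 + y ^ 2 := by
  rcases le_total x y with h | h
  · calc x * y ≤ y * y := by gcongr
      _ = y ^ 2 := by ring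
      _ ≤ _ := le_add_self
  · calc x * y ≤ x * x := by gcongr
      _ = x ^ 2 := by ring
      _ ≤ _ := le_self_add

lemma sq_add_le4 (x y : ℝ≥0∞) : (x + y) ^ 2 ≤ 4 * (x ^ 2 + y ^ 2) := by
  calc (x + y) ^ 2 = x ^ 2 + y ^ 2 + 2 * (x * y) := by ring
    _ ≤ x ^ 2 + y ^ 2 + 2 * (x ^ 2 + y ^ 2) := by gcongr; exact mul_le_sq_add x y
    _ = 3 * (x ^ 2 + y ^ 2) := by ring
    _ ≤ _ := by gcongr; norm_num

lemma tsum_sq_eq {ι : Type*} (f : ι → ℝ≥0∞) : (∑' m, f m) ^ 2 = ∑' m, ∑' n, f m * f n := by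
  rw [sq, ← ENNReal.tsum_mul_right]
  apply tsum_congr
  intro m
  rw [ENNReal.tsum_mul_left]

lemma cs_tsum (f g : ℤ → ℝ≥0∞) :
    (∑' m, f m * g m) ^ 2 ≤ 2 * ((∑' m, f m ^ 2) * ∑' m, g m ^ 2) := by
  rw [tsum_sq_eq]
  calc ∑' m, ∑' n, f m * g m * (f n * g n)
      ≤ ∑' m, ∑' n, (f m ^ 2 * g n ^ 2 + g m ^ 2 * f n ^ 2) := by
        refine ENNReal.tsum_le_tsum fun m => ENNReal.tsum_le_tsum fun n => ?_
        calc f m * g m * (f n * g n) = (f m * g n) * (g m * f n) := by ring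
          _ ≤ (f m * g n) ^ 2 + (g m * f n) ^ 2 := mul_le_sq_add _ _
          _ = _ := by ring
    _ = _ := by
        simp_rw [ENNReal.tsum_add, ENNReal.tsum_mul_left, ENNReal.tsum_mul_right]
        ring

lemma young (c y : ℤ → ℝ≥0∞) :
    ∑' l, (cv c y l) ^ 2 ≤ 2 * ((∑' m, c m) ^ 2 * ∑' m, y m ^ 2) := by
  have hs : ∀ m : ℤ, ∑' l : ℤ, y (l - m) ^ 2 = ∑' l, y l ^ 2 := fun m =>
    (Equiv.subRight m).tsum_eq (fun l => y l ^ 2)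
  calc ∑' l, (cv c y l) ^ 2
      ≤ ∑' l, ∑' m, ∑' n, (c m * c n * y (l - m) ^ 2 + c m * c n * y (l - n) ^ 2) := by
        refine ENNReal.tsum_le_tsum fun l => ?_
        unfold cv
        rw [tsum_sq_eq]
        refine ENNReal.tsum_le_tsum fun m => ENNReal.tsum_le_tsum fun n => ?_
        calc c m * y (l - m) * (c n * y (l - n)) = c m * c n * (y (l - m) * y (l - n)) := by ring
          _ ≤ c m * c n * (y (l - m) ^ 2 + y (l - n) ^ 2) := by
            gcongr; exact mul_le_sq_add _ _
          _ = _ := by ring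
    _ = ∑' m, ∑' n, ∑' l, (c m * c n * y (l - m) ^ 2 + c m * c n * y (l - n) ^ 2) := by
        rw [ENNReal.tsum_comm]
        apply tsum_congr; intro m
        rw [ENNReal.tsum_comm]
    _ = _ := by
        simp_rw [ENNReal.tsum_add, ENNReal.tsum_mul_left, hs, ENNReal.tsum_mul_right,
          tsum_sq_eq c]
        simp_rw [ENNReal.tsum_mul_left, ENNReal.tsum_mul_right]
        ring

lemma one_le_zeta (a b : ℝ) (l : ℤ) : 1 ≤ zeta a b l := by
  unfold zeta
  rw [Real.one_le_sqrt]
  nlinarith [sq_nonneg (mu a b l)]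

lemma zeta_neg (a b : ℝ) (l : ℤ) : zeta a b (-l) = zeta a b l := by
  unfold zeta mu
  congr 1
  push_cast
  ring

lemma zeta_sub (a b : ℝ) (l m : ℤ) : zeta a b l ≤ zeta a b m + zeta a b (l - m) := by
  have h : mu a b l = mu a b m + mu a b (l - m) := by
    unfold mu; push_cast; ring
  unfold zeta
  rw [h]
  set x := mu a b m
  set y := mu a b (l - m)
  have hx : |x| ≤ √(1 + x ^ 2) := Real.abs_le_sqrt (by linarith)
  have hy : |y| ≤ √(1 + y ^ 2) := Real.abs_le_sqrt (by linarith)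
  have h1 : √(1 + x ^ 2) ^ 2 = 1 + x ^ 2 := Real.sq_sqrt (by positivity)
  have h2 : √(1 + y ^ 2) ^ 2 = 1 + y ^ 2 := Real.sq_sqrt (by positivity)
  have h3 : x * y ≤ √(1 + x ^ 2) * √(1 + y ^ 2) := by
    calc x * y ≤ |x * y| := le_abs_self _
      _ = |x| * |y| := abs_mul _ _
      _ ≤ _ := by gcongr
  exact Real.sqrt_le_iff.mpr ⟨by positivity, by nlinarith⟩

lemma one_le_zz (a b : ℝ) (l : ℤ) : 1 ≤ zz a b l := by
  unfold zz
  exact ENNReal.one_le_ofReal.mpr (one_le_zeta a b l)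

lemma zz_ne_top (a b : ℝ) (l : ℤ) : zz a b l ≠ ⊤ := ENNReal.ofReal_ne_top

lemma zz_ne_zero (a b : ℝ) (l : ℤ) : zz a b l ≠ 0 :=
  (lt_of_lt_of_le one_pos (one_le_zz a b l)).ne'

lemma zz_sub (a b : ℝ) (l m : ℤ) : zz a b l ≤ zz a b m + zz a b (l - m) := by
  unfold zz
  rw [← ENNReal.ofReal_add (by linarith [one_le_zeta a b m]) (by linarith [one_le_zeta a b (l-m)])]
  exact ENNReal.ofReal_le_ofReal (zeta_sub a b l m)

lemma zz_sub_mul (a b : ℝ) (l m : ℤ) : zz a b l ≤ 2 * (zz a b m * zz a b (l - m)) := by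
  refine (zz_sub a b l m).trans ?_
  rw [two_mul]
  gcongr
  · exact le_mul_of_one_le_right' (one_le_zz _ _ _)
  · exact le_mul_of_one_le_left' (one_le_zz _ _ _)

lemma summ_zz (a b : ℝ) (hab : a < b) : ∑' l, ((zz a b l)⁻¹) ^ 2 ≠ ⊤ := by
  have h1 : Summable fun l : ℤ => (1 + mu a b l ^ 2)⁻¹ := by
    have hc : 0 < 2 * Real.pi / (b - a) := by
      have := Real.pi_pos
      have : 0 < b - a := by linarith
      positivity
    have hb : Summable fun l : ℤ => ((2 * Real.pi / (b - a)) ^ 2)⁻¹ * (1 / (l : ℝ) ^ 2)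
        + (if l = 0 then (1 : ℝ) else 0) := by
      apply Summable.add
      · exact (Real.summable_one_div_int_pow.mpr (by norm_num)).mul_left _
      · exact (hasSum_ite_eq 0 (1 : ℝ)).summable
    refine Summable.of_nonneg_of_le (fun l => by positivity) (fun l => ?_) hb
    by_cases hl : l = 0
    · subst hl
      simp [mu]
    · have hl' : (l : ℝ) ≠ 0 := by exact_mod_cast hl
      have h2 : (0 : ℝ) < (l : ℝ) ^ 2 := by positivity
      simp only [hl, if_false, add_zero]
      have : mu a b l = 2 * Real.pi / (b - a) * l := by unfold mu; ring
      rw [this, one_div, ← mul_inv, mul_pow]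
      gcongr
      linarith
  have h3 : ∀ l, ((zz a b l)⁻¹) ^ 2 = ENNReal.ofReal ((1 + mu a b l ^ 2)⁻¹) := by
    intro l
    unfold zz zeta
    rw [← ENNReal.ofReal_inv_of_pos (Real.sqrt_pos.mpr (by positivity)),
      ← ENNReal.ofReal_pow (by positivity), inv_pow, Real.sq_sqrt (by positivity)]
  simp_rw [h3]
  exact h1.tsum_ofReal_ne_top

lemma QQ_mono_fun (a b σ : ℝ) {X Y : ℤ → ℝ≥0∞} (h : ∀ l, X l ≤ Y l) :
    QQ a b σ X ≤ QQ a b σ Y := by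
  unfold QQ
  refine ENNReal.tsum_le_tsum fun l => ?_
  gcongr
  exact h l

lemma QQ_mono (a b : ℝ) {σ σ' : ℝ} (h : σ ≤ σ') (X : ℤ → ℝ≥0∞) :
    QQ a b σ X ≤ QQ a b σ' X := by
  unfold QQ
  refine ENNReal.tsum_le_tsum fun l => ?_
  gcongr
  exact one_le_zz a b l

lemma QQ_add (a b σ : ℝ) (X Y : ℤ → ℝ≥0∞) :
    QQ a b σ (fun l => X l + Y l) ≤ 4 * (QQ a b σ X + QQ a b σ Y) := by
  unfold QQ
  rw [← ENNReal.tsum_add, ← ENNReal.tsum_mul_left]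
  refine ENNReal.tsum_le_tsum fun l => ?_
  rw [mul_add]
  exact sq_add_le4 _ _

lemma QQ_smul (a b σ : ℝ) (c : ℝ≥0∞) (X : ℤ → ℝ≥0∞) :
    QQ a b σ (fun l => c * X l) = c ^ 2 * QQ a b σ X := by
  unfold QQ
  rw [← ENNReal.tsum_mul_left]
  apply tsum_congr; intro l; ring

lemma QQ_zz (a b σ : ℝ) (X : ℤ → ℝ≥0∞) :
    QQ a b σ (fun l => zz a b l * X l) = QQ a b (σ + 1) X := by
  unfold QQ
  apply tsum_congr; intro l
  rw [ENNReal.rpow_add _ _ (zz_ne_zero a b l) (zz_ne_top a b l), ENNReal.rpow_one]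
  ring

lemma QQ_ne_top (a b σ : ℝ) (hσ : 0 ≤ σ) {X : ℤ → ℝ≥0∞} (h : QQ a b σ X ≠ ⊤) (l : ℤ) :
    X l ≠ ⊤ := by
  intro hX
  apply h
  rw [eq_top_iff]
  refine le_trans ?_ (ENNReal.le_tsum l)
  rw [hX, ENNReal.mul_top]
  · simp
  · have := ENNReal.one_le_rpow (one_le_zz a b l) (z := σ)
    rcases hσ.eq_or_lt with h | h
    · simp [← h]
    · exact (lt_of_lt_of_le one_pos (this h)).ne'

lemma QQ_cv (a b : ℝ) (hab : a < b) (σ : ℝ) (hσ : 0 ≤ σ) :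
    ∃ C : ℝ≥0∞, C ≠ ⊤ ∧ ∀ X Y, QQ a b σ (cv X Y) ≤ C * (QQ a b (σ + 1) X * QQ a b σ Y) := by
  refine ⟨(2 ^ σ) ^ 2 * (4 * ∑' l, ((zz a b l)⁻¹) ^ 2), ?_, ?_⟩
  · refine ENNReal.mul_ne_top ?_ (ENNReal.mul_ne_top (by norm_num) (summ_zz a b hab))
    exact ENNReal.pow_ne_top (ENNReal.rpow_ne_top_of_nonneg hσ (by norm_num))
  intro X Y
  have h1 : ∀ l, zz a b l ^ σ * cv X Y l ≤
      2 ^ σ * cv (fun m => zz a b m ^ σ * X m) (fun m => zz a b m ^ σ * Y m) l := by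
    intro l
    unfold cv
    rw [← ENNReal.tsum_mul_left, ← ENNReal.tsum_mul_left]
    refine ENNReal.tsum_le_tsum fun m => ?_
    calc zz a b l ^ σ * (X m * Y (l - m))
        ≤ (2 * (zz a b m * zz a b (l - m))) ^ σ * (X m * Y (l - m)) := by
          gcongr; exact zz_sub_mul a b l m
      _ = _ := by
          rw [ENNReal.mul_rpow_of_nonneg _ _ hσ, ENNReal.mul_rpow_of_nonneg _ _ hσ]
          ring
  have h2 : (∑' m, zz a b m ^ σ * X m) ^ 2 ≤
      2 * ((∑' l, ((zz a b l)⁻¹) ^ 2) * QQ a b (σ + 1) X) := by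
    have : ∀ m, zz a b m ^ σ * X m = (zz a b m)⁻¹ * (zz a b m ^ (σ + 1) * X m) := by
      intro m
      rw [ENNReal.rpow_add _ _ (zz_ne_zero a b m) (zz_ne_top a b m), ENNReal.rpow_one]
      calc zz a b m ^ σ * X m = ((zz a b m)⁻¹ * zz a b m) * (zz a b m ^ σ * X m) := by
            rw [ENNReal.inv_mul_cancel (zz_ne_zero a b m) (zz_ne_top a b m), one_mul]
        _ = _ := by ring
    simp_rw [this]
    exact cs_tsum _ _
  calc QQ a b σ (cv X Y)
      ≤ ∑' l, (2 ^ σ * cv (fun m => zz a b m ^ σ * X m) (fun m => zz a b m ^ σ * Y m) l) ^ 2 := by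
        unfold QQ
        refine ENNReal.tsum_le_tsum fun l => ?_
        exact pow_le_pow_left' (h1 l) 2
    _ = (2 ^ σ) ^ 2 *
        ∑' l, (cv (fun m => zz a b m ^ σ * X m) (fun m => zz a b m ^ σ * Y m) l) ^ 2 := by
        rw [← ENNReal.tsum_mul_left]
        apply tsum_congr; intro l; ring
    _ ≤ (2 ^ σ) ^ 2 * (2 * ((∑' m, zz a b m ^ σ * X m) ^ 2 * QQ a b σ Y)) := by
        gcongr
        exact young _ _
    _ ≤ (2 ^ σ) ^ 2 * (2 * ((2 * ((∑' l, ((zz a b l)⁻¹) ^ 2) * QQ a b (σ + 1) X)) *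
          QQ a b σ Y)) := by gcongr
    _ = _ := by ring

/-- algebra property -/
lemma QQ_alg (a b : ℝ) (hab : a < b) (σ : ℝ) (hσ : 0 ≤ σ) :
    ∃ C : ℝ≥0∞, C ≠ ⊤ ∧ ∀ X Y,
      QQ a b (σ + 1) (cv X Y) ≤ C * (QQ a b (σ + 1) X * QQ a b (σ + 1) Y) := by
  obtain ⟨C, hC, h⟩ := QQ_cv a b hab σ hσ
  refine ⟨8 * C, ENNReal.mul_ne_top (by norm_num) hC, fun X Y => ?_⟩
  rw [← QQ_zz]
  have h1 : ∀ l, zz a b l * cv X Y l ≤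
      cv (fun m => zz a b m * X m) Y l + cv X (fun m => zz a b m * Y m) l := by
    intro l
    unfold cv
    rw [← ENNReal.tsum_mul_left, ← ENNReal.tsum_add]
    refine ENNReal.tsum_le_tsum fun m => ?_
    calc zz a b l * (X m * Y (l - m)) ≤ (zz a b m + zz a b (l - m)) * (X m * Y (l - m)) := by
          gcongr; exact zz_sub a b l m
      _ = _ := by ring
  refine (QQ_mono_fun a b σ h1).trans ((QQ_add _ _ _ _ _).trans ?_)
  have h2 := h X (fun m => zz a b m * Y m)
  have h3 := h Y (fun m => zz a b m * X m)
  rw [cv_comm, QQ_zz] at h3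
  rw [QQ_zz] at h2
  calc _ ≤ 4 * (C * (QQ a b (σ + 1) Y * QQ a b (σ + 1) X) +
        C * (QQ a b (σ + 1) X * QQ a b (σ + 1) Y)) := by gcongr
    _ = _ := by ring

lemma cv_bound {u v : ℤ → ℂ} {X Y : ℤ → ℝ≥0∞} (hu : ∀ l, ‖u l‖ₑ ≤ X l) (hv : ∀ l, ‖v l‖ₑ ≤ Y l)
    (l : ℤ) : ‖convC u v l‖ₑ ≤ cv X Y l := by
  unfold convC cv
  have h : ∀ m, ‖u m * v (l - m)‖ₑ ≤ X m * Y (l - m) := by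
    intro m
    rw [enorm_mul]
    gcongr
    · exact hu m
    · exact hv _
  refine le_trans ?_ (ENNReal.tsum_le_tsum h)
  by_cases ht : ∑' m, ‖u m * v (l - m)‖ₑ = ⊤
  · rw [ht]; exact le_top
  · exact enorm_tsum_le_tsum_enorm

lemma term_bound {u v : ℤ → ℂ} {X Y : ℤ → ℝ≥0∞} (hu : ∀ l, ‖u l‖ₑ ≤ X l)
    (hv : ∀ l, ‖v l‖ₑ ≤ Y l) {l : ℤ} (h : cv X Y l ≠ ⊤) (m : ℤ) :
    ‖u m * v (l - m)‖ ≤ (X m * Y (l - m)).toReal := by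
  have ht : X m * Y (l - m) ≠ ⊤ := ENNReal.ne_top_of_tsum_ne_top h m
  rw [← toReal_enorm]
  apply ENNReal.toReal_mono ht
  rw [enorm_mul]
  gcongr
  · exact hu m
  · exact hv _

lemma term_summable {X Y : ℤ → ℝ≥0∞} {l : ℤ} (h : cv X Y l ≠ ⊤) :
    Summable fun m => (X m * Y (l - m)).toReal := ENNReal.summable_toReal h

lemma conv_summable {u v : ℤ → ℂ} {X Y : ℤ → ℝ≥0∞} (hu : ∀ l, ‖u l‖ₑ ≤ X l)
    (hv : ∀ l, ‖v l‖ₑ ≤ Y l) {l : ℤ} (h : cv X Y l ≠ ⊤) :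
    Summable fun m => u m * v (l - m) :=
  Summable.of_norm_bounded (term_summable h) (term_bound hu hv h)

lemma conv_cont {u v : ℝ → ℤ → ℂ} {X Y : ℤ → ℝ≥0∞} (hu : ∀ t l, ‖u t l‖ₑ ≤ X l)
    (hv : ∀ t l, ‖v t l‖ₑ ≤ Y l) (cu : ∀ l, Continuous fun t => u t l)
    (hcv : ∀ l, Continuous fun t => v t l) {l : ℤ} (h : cv X Y l ≠ ⊤) :
    Continuous fun t => convC (u t) (v t) l := by
  unfold convC
  exact continuous_tsum (fun m => (cu m).mul (hcv _)) (term_summable h)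
    (fun m t => term_bound (hu t) (hv t) h m)

lemma conv_deriv {u v u1 v1 : ℝ → ℤ → ℂ} {X Y X1 Y1 : ℤ → ℝ≥0∞} (hu : ∀ t l, ‖u t l‖ₑ ≤ X l)
    (hv : ∀ t l, ‖v t l‖ₑ ≤ Y l) (hu1 : ∀ t l, ‖u1 t l‖ₑ ≤ X1 l)
    (hv1 : ∀ t l, ‖v1 t l‖ₑ ≤ Y1 l)
    (du : ∀ t l, HasDerivAt (fun t => u t l) (u1 t l) t)
    (dv : ∀ t l, HasDerivAt (fun t => v t l) (v1 t l) t) {l : ℤ}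
    (h : cv X Y l ≠ ⊤) (h1 : cv X1 Y l ≠ ⊤) (h2 : cv X Y1 l ≠ ⊤) (t : ℝ) :
    HasDerivAt (fun t => convC (u t) (v t) l)
      (convC (u1 t) (v t) l + convC (u t) (v1 t) l) t := by
  unfold convC
  rw [← (conv_summable (hu1 t) (hv t) h1).tsum_add (conv_summable (hu t) (hv1 t) h2)]
  refine hasDerivAt_tsum (g := fun m t => u t m * v t (l - m))
    (g' := fun m t => u1 t m * v t (l - m) + u t m * v1 t (l - m))
    ((term_summable h1).add (term_summable h2)) (fun m t => (du t m).mul (dv t _))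
    (fun m t => (norm_add_le _ _).trans
      (add_le_add (term_bound (hu1 t) (hv t) h1 m) (term_bound (hu t) (hv1 t) h2 m)))
    (y₀ := 0) (conv_summable (hu 0) (hv 0) h) t

/-- A twice differentiable curve of sequences, with bounds. -/
def Good (a b s : ℝ) (u : ℝ → ℤ → ℂ) (K : ℝ≥0∞) : Prop :=
  ∃ (u1 u2 : ℝ → ℤ → ℂ) (X X1 X2 : ℤ → ℝ≥0∞),
    (∀ t l, HasDerivAt (fun t => u t l) (u1 t l) t) ∧
    (∀ t l, HasDerivAt (fun t => u1 t l) (u2 t l) t) ∧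
    (∀ l, Continuous fun t => u2 t l) ∧
    (∀ t l, ‖u t l‖ₑ ≤ X l) ∧ (∀ t l, ‖u1 t l‖ₑ ≤ X1 l) ∧ (∀ t l, ‖u2 t l‖ₑ ≤ X2 l) ∧
    QQ a b (s + 1) X ≤ K ∧ QQ a b s X1 ≤ K ∧ QQ a b (s - 1) X2 ≤ K

lemma Good.conv (a b : ℝ) (hab : a < b) (s : ℝ) (hs : 1 ≤ s) :
    ∃ C : ℝ≥0∞, C ≠ ⊤ ∧ ∀ (u v : ℝ → ℤ → ℂ) (K L : ℝ≥0∞), K ≠ ⊤ → L ≠ ⊤ →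
      Good a b s u K → Good a b s v L →
      Good a b s (fun t => convC (u t) (v t)) (C * (K * L)) := by
  obtain ⟨A, hA, HA⟩ := QQ_alg a b hab s (by linarith)
  obtain ⟨B, hB, HB⟩ := QQ_cv a b hab s (by linarith)
  obtain ⟨D, hD, HD⟩ := QQ_cv a b hab (s - 1) (by linarith)
  refine ⟨A + 8 * B + 64 * D, ?_, ?_⟩
  · simp [ENNReal.mul_eq_top, hA, hB, hD]
  intro u v K L hK hL ⟨u1, u2, X, X1, X2, du, du1, cu, bu, bu1, bu2, qu, qu1, qu2⟩
    ⟨v1, v2, Y, Y1, Y2, dv, dv1, hcv, bv, bv1, bv2, qv, qv1, qv2⟩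
  have hKL : K * L ≠ ⊤ := ENNReal.mul_ne_top hK hL
  have e1 : s - 1 + 1 = s := by ring
  rw [e1] at HD
  have q00 : QQ a b (s + 1) (cv X Y) ≤ A * (K * L) := (HA X Y).trans (by gcongr)
  have q01 : QQ a b s (cv X Y1) ≤ B * (K * L) := (HB X Y1).trans (by gcongr)
  have q10 : QQ a b s (cv X1 Y) ≤ B * (K * L) := by
    rw [cv_comm]
    refine (HB Y X1).trans ?_
    rw [mul_comm K L]; gcongr
  have q11 : QQ a b (s - 1) (cv X1 Y1) ≤ D * (K * L) := by
    refine (HD X1 Y1).trans ?_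
    gcongr
    exact (QQ_mono a b (by linarith) _).trans qv1
  have q02 : QQ a b (s - 1) (cv X Y2) ≤ D * (K * L) := by
    refine (HD X Y2).trans ?_
    gcongr
    exact (QQ_mono a b (by linarith) _).trans qu
  have q20 : QQ a b (s - 1) (cv X2 Y) ≤ D * (K * L) := by
    rw [cv_comm]
    refine (HD Y X2).trans ?_
    rw [mul_comm K L]
    gcongr
    exact (QQ_mono a b (by linarith) _).trans qv
  have n00 := QQ_ne_top a b (s + 1) (by linarith) (ne_top_of_le_ne_top (ENNReal.mul_ne_top hA hKL) q00)
  have n01 := QQ_ne_top a b s (by linarith) (ne_top_of_le_ne_top (ENNReal.mul_ne_top hB hKL) q01)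
  have n10 := QQ_ne_top a b s (by linarith) (ne_top_of_le_ne_top (ENNReal.mul_ne_top hB hKL) q10)
  have n11 := QQ_ne_top a b (s-1) (by linarith) (ne_top_of_le_ne_top (ENNReal.mul_ne_top hD hKL) q11)
  have n02 := QQ_ne_top a b (s-1) (by linarith) (ne_top_of_le_ne_top (ENNReal.mul_ne_top hD hKL) q02)
  have n20 := QQ_ne_top a b (s-1) (by linarith) (ne_top_of_le_ne_top (ENNReal.mul_ne_top hD hKL) q20)
  have ccu : ∀ l, Continuous fun t => u t l := fun l =>
    continuous_iff_continuousAt.mpr fun t => (du t l).continuousAt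
  have ccu1 : ∀ l, Continuous fun t => u1 t l := fun l =>
    continuous_iff_continuousAt.mpr fun t => (du1 t l).continuousAt
  have ccv : ∀ l, Continuous fun t => v t l := fun l =>
    continuous_iff_continuousAt.mpr fun t => (dv t l).continuousAt
  have ccv1 : ∀ l, Continuous fun t => v1 t l := fun l =>
    continuous_iff_continuousAt.mpr fun t => (dv1 t l).continuousAt
  refine ⟨fun t l => convC (u1 t) (v t) l + convC (u t) (v1 t) l,
    fun t l => (convC (u2 t) (v t) l + convC (u1 t) (v1 t) l) +
      (convC (u1 t) (v1 t) l + convC (u t) (v2 t) l),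
    cv X Y, fun l => cv X1 Y l + cv X Y1 l,
    fun l => (cv X2 Y l + cv X1 Y1 l) + (cv X1 Y1 l + cv X Y2 l), ?_, ?_, ?_, ?_, ?_, ?_, ?_, ?_, ?_⟩
  · intro t l
    exact conv_deriv bu bv bu1 bv1 du dv (n00 l) (n10 l) (n01 l) t
  · intro t l
    exact (conv_deriv bu1 bv bu2 bv1 du1 dv (n10 l) (n20 l) (n11 l) t).add
      (conv_deriv bu bv1 bu1 bv2 du dv1 (n01 l) (n11 l) (n02 l) t)
  · intro l
    exact ((conv_cont bu2 bv cu ccv (n20 l)).add (conv_cont bu1 bv1 ccu1 ccv1 (n11 l))).add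
      ((conv_cont bu1 bv1 ccu1 ccv1 (n11 l)).add (conv_cont bu bv2 ccu hcv (n02 l)))
  · exact fun t l => cv_bound (bu t) (bv t) l
  · exact fun t l => (enorm_add_le _ _).trans
      (add_le_add (cv_bound (bu1 t) (bv t) l) (cv_bound (bu t) (bv1 t) l))
  · exact fun t l => (enorm_add_le _ _).trans (add_le_add
      ((enorm_add_le _ _).trans
        (add_le_add (cv_bound (bu2 t) (bv t) l) (cv_bound (bu1 t) (bv1 t) l)))
      ((enorm_add_le _ _).trans
        (add_le_add (cv_bound (bu1 t) (bv1 t) l) (cv_bound (bu t) (bv2 t) l))))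
  · refine q00.trans ?_
    gcongr
    rw [add_assoc]
    exact le_self_add
  · calc _ ≤ 4 * (B * (K * L) + B * (K * L)) := (QQ_add _ _ _ _ _).trans (by gcongr)
      _ = (8 * B) * (K * L) := by ring
      _ ≤ _ := by
        gcongr
        exact le_trans le_add_self le_self_add
  · calc _ ≤ 4 * (4 * (D * (K * L) + D * (K * L)) + 4 * (D * (K * L) + D * (K * L))) :=
        (QQ_add _ _ _ _ _).trans (by
          gcongr
          · exact (QQ_add _ _ _ _ _).trans (by gcongr)
          · exact (QQ_add _ _ _ _ _).trans (by gcongr))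
      _ = (64 * D) * (K * L) := by ring
      _ ≤ _ := by
        gcongr
        exact le_add_self

lemma Good.one (a b s : ℝ) : Good a b s (fun _ => oneC) 1 := by
  refine ⟨fun _ _ => 0, fun _ _ => 0, fun l => if l = 0 then 1 else 0, fun _ => 0, fun _ => 0,
    fun t l => hasDerivAt_const t _, fun t l => hasDerivAt_const t _, fun l => continuous_const,
    ?_, by simp, by simp, ?_, by simp [QQ], by simp [QQ]⟩
  · intro t l
    simp only [oneC]
    split_ifs <;> simp
  · unfold QQ
    rw [tsum_eq_single 0]
    · simp [zz, zeta, mu]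
    · intro l hl
      simp [hl]

lemma Good.pow (a b : ℝ) (hab : a < b) (s : ℝ) (hs : 1 ≤ s) (n : ℕ) :
    ∃ C : ℝ≥0∞, C ≠ ⊤ ∧ ∀ (u : ℝ → ℤ → ℂ) (K : ℝ≥0∞), K ≠ ⊤ → Good a b s u K →
      Good a b s (fun t => powC (u t) n) (C * K ^ n) := by
  induction n with
  | zero => exact ⟨1, by simp, fun u K _ _ => by simpa [powC] using Good.one a b s⟩
  | succ n ih =>
    obtain ⟨C, hC, h⟩ := ih
    obtain ⟨D, hD, H⟩ := Good.conv a b hab s hs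
    refine ⟨D * C, ENNReal.mul_ne_top hD hC, fun u K hK hu => ?_⟩
    have := H u _ K (C * K ^ n) hK (ENNReal.mul_ne_top hC (ENNReal.pow_ne_top hK)) hu (h u K hK hu)
    have e : D * C * K ^ (n + 1) = D * (K * (C * K ^ n)) := by ring
    rw [e]
    exact this

lemma zz_sq_rpow (a b σ : ℝ) (l : ℤ) :
    (zz a b l ^ σ) ^ 2 = ENNReal.ofReal ((1 + mu a b l ^ 2) ^ σ) := by
  have h0 : (0 : ℝ) < 1 + mu a b l ^ 2 := by positivity
  unfold zz zeta
  rw [ENNReal.ofReal_rpow_of_pos (Real.sqrt_pos.mpr h0), ← ENNReal.ofReal_pow (by positivity),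
    Real.sqrt_eq_rpow, ← Real.rpow_mul h0.le, ← Real.rpow_natCast, ← Real.rpow_mul h0.le]
  congr 2
  push_cast
  ring

lemma QQ_term (a b σ : ℝ) (c : ℤ → ℂ) (l : ℤ) :
    (zz a b l ^ σ * ‖c l‖ₑ) ^ 2 = ENNReal.ofReal ((1 + mu a b l ^ 2) ^ σ * ‖c l‖ ^ 2) := by
  rw [mul_pow, zz_sq_rpow, ENNReal.ofReal_mul (by positivity), ENNReal.ofReal_pow (by positivity),
    ofReal_norm]

lemma QQ_memHs (a b σ : ℝ) (c : ℤ → ℂ) (h : MemHs a b σ c) :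
    QQ a b σ (fun l => ‖c l‖ₑ) = ENNReal.ofReal (sobNormSq a b σ c) := by
  unfold QQ sobNormSq
  simp_rw [QQ_term]
  rw [ENNReal.ofReal_tsum_of_nonneg (fun l => by positivity) h]

lemma sobNormSq_le (a b σ : ℝ) (c : ℤ → ℂ) (M : ℝ) (hM : 0 ≤ M)
    (h : QQ a b σ (fun l => ‖c l‖ₑ) ≤ ENNReal.ofReal M) : sobNormSq a b σ c ≤ M := by
  have : sobNormSq a b σ c = (QQ a b σ (fun l => ‖c l‖ₑ)).toReal := by
    unfold QQ sobNormSq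
    simp_rw [QQ_term]
    rw [ENNReal.tsum_toReal_eq (fun l => ENNReal.ofReal_ne_top)]
    apply tsum_congr; intro l
    rw [ENNReal.toReal_ofReal (by positivity)]
  rw [this]
  exact ENNReal.toReal_le_of_le_ofReal hM h

lemma exp_deriv (z : ℂ) (t : ℝ) :
    HasDerivAt (fun t : ℝ => Complex.exp (z * (t : ℂ))) (z * Complex.exp (z * (t : ℂ))) t := by
  have h := ((Complex.ofRealCLM.hasDerivAt (x := t)).const_mul z).cexp
  simpa [mul_comm] using h

lemma exp_enorm (x t : ℝ) : ‖Complex.exp (Complex.I * (x : ℂ) * (t : ℂ))‖ₑ = 1 := by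
  have : ‖Complex.exp (Complex.I * (x : ℂ) * (t : ℂ))‖ = 1 := by
    have := Complex.norm_exp_ofReal_mul_I (x * t)
    rw [← this]; congr 2; push_cast; ring
  rw [← ofReal_norm, this]; simp

lemma zeta_enorm (a b : ℝ) (l : ℤ) : ‖(zeta a b l : ℂ)‖ₑ = zz a b l := by
  rw [← ofReal_norm, Complex.norm_real, Real.norm_of_nonneg (by linarith [one_le_zeta a b l])]
  rfl

lemma half_bound (x y : ℂ) : ‖(x + y) / 2‖ₑ ≤ ‖x‖ₑ + ‖y‖ₑ := by
  refine le_trans ?_ (enorm_add_le x y)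
  rw [← ofReal_norm, ← ofReal_norm]
  apply ENNReal.ofReal_le_ofReal
  rw [norm_div]
  simp only [Complex.norm_ofNat]
  linarith [norm_nonneg (x + y)]

lemma Good.wave (a b s : ℝ) (ψ : ℤ → ℂ) :
    Good a b s (fun t => reC (expJ a b t ψ)) (8 * QQ a b (s + 1) (fun l => ‖ψ l‖ₑ)) := by
  set z : ℤ → ℂ := fun l => Complex.I * (zeta a b l : ℂ) with hz
  set z' : ℤ → ℂ := fun l => Complex.I * ((-zeta a b l : ℝ) : ℂ) with hz'
  set q : ℤ → ℂ := fun l => (starRingEnd ℂ) (ψ (-l)) with hq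
  have e0 : ∀ t l, reC (expJ a b t ψ) l =
      (Complex.exp (z l * (t : ℂ)) * ψ l + Complex.exp (z' l * (t : ℂ)) * q l) / 2 := by
    intro t l
    simp only [reC, expJ, conjC, hz, hz', hq, map_mul, ← Complex.exp_conj, Complex.conj_I,
      Complex.conj_ofReal, zeta_neg]
    congr 2
    · ring_nf
    · congr 2; push_cast; ring
  set v : ℤ → ℝ≥0∞ := fun l => ‖ψ l‖ₑ + ‖ψ (-l)‖ₑ with hv
  have qe : ∀ l, ‖q l‖ₑ = ‖ψ (-l)‖ₑ := by
    intro l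
    rw [← ofReal_norm, ← ofReal_norm]
    simp [hq]
  have ze : ∀ l, ‖z l‖ₑ = zz a b l := by
    intro l
    simp only [hz]
    rw [enorm_mul, zeta_enorm, ← ofReal_norm, Complex.norm_I]; simp
  have ze' : ∀ l, ‖z' l‖ₑ = zz a b l := by
    intro l
    simp only [hz']
    rw [enorm_mul, Complex.ofReal_neg, enorm_neg, zeta_enorm, ← ofReal_norm, Complex.norm_I]; simp
  have xe : ∀ (t : ℝ) l, ‖Complex.exp (z l * (t : ℂ))‖ₑ = 1 := fun t l => exp_enorm _ _
  have xe' : ∀ (t : ℝ) l, ‖Complex.exp (z' l * (t : ℂ))‖ₑ = 1 := fun t l => exp_enorm _ _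
  have qv : QQ a b (s + 1) v ≤ 8 * QQ a b (s + 1) (fun l => ‖ψ l‖ₑ) := by
    have hn : QQ a b (s + 1) (fun l => ‖ψ (-l)‖ₑ) = QQ a b (s + 1) (fun l => ‖ψ l‖ₑ) := by
      unfold QQ
      rw [← (Equiv.neg ℤ).tsum_eq]
      apply tsum_congr; intro l
      simp [zz, zeta_neg]
    refine (QQ_add _ _ _ _ _).trans ?_
    rw [hn, ← two_mul, ← mul_assoc]
    norm_num
  refine ⟨fun t l => (z l * Complex.exp (z l * (t : ℂ)) * ψ l +
      z' l * Complex.exp (z' l * (t : ℂ)) * q l) / 2,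
    fun t l => (z l * (z l * Complex.exp (z l * (t : ℂ))) * ψ l +
      z' l * (z' l * Complex.exp (z' l * (t : ℂ))) * q l) / 2,
    v, fun l => zz a b l * v l, fun l => zz a b l * (zz a b l * v l), ?_, ?_, ?_, ?_, ?_, ?_,
    ?_, ?_, ?_⟩
  · intro t l
    simp_rw [e0]
    exact (((exp_deriv (z l) t).mul_const _).add ((exp_deriv (z' l) t).mul_const _)).div_const 2
  · intro t l
    exact ((((exp_deriv (z l) t).const_mul (z l)).mul_const _).add
      (((exp_deriv (z' l) t).const_mul (z' l)).mul_const _)).div_const 2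
  · intro l
    fun_prop
  · intro t l
    simp only [e0]
    refine (half_bound _ _).trans ?_
    simp [enorm_mul, xe, xe', qe, hv]
  · intro t l
    refine (half_bound _ _).trans ?_
    simp [enorm_mul, xe, xe', qe, ze, ze', hv, mul_add]
  · intro t l
    refine (half_bound _ _).trans ?_
    simp [enorm_mul, xe, xe', qe, ze, ze', hv, mul_add, mul_assoc]
  · exact qv
  · rw [QQ_zz]; exact qv
  · rw [QQ_zz, QQ_zz]
    convert qv using 2
    ring

lemma peano (f f1 f2 : ℝ → ℂ) (h1 : ∀ t, HasDerivAt f (f1 t) t)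
    (h2 : ∀ t, HasDerivAt f1 (f2 t) t) (h3 : Continuous f2) (τ : ℝ) :
    (τ : ℂ) * f (τ / 2) - ∫ θ in (0 : ℝ)..τ, f θ = -((τ : ℂ) ^ 3) *
      ∫ θ in (0 : ℝ)..(1 : ℝ), ((min (θ ^ 2) ((1 - θ) ^ 2) / 2 : ℝ) : ℂ) * f2 (θ * τ) := by
  have cf : Continuous f := continuous_iff_continuousAt.mpr fun t => (h1 t).continuousAt
  set P : ℝ → ℂ := fun x => ∫ θ in (0 : ℝ)..x, f θ with hP
  have dP : ∀ x, HasDerivAt P (f x) x := fun x =>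
    intervalIntegral.integral_hasDerivAt_right (cf.intervalIntegrable _ _)
      (cf.stronglyMeasurableAtFilter _ _) cf.continuousAt
  have sc : ∀ (g : ℝ → ℂ) (g' : ℂ) (x : ℝ), HasDerivAt g g' (x * τ) →
      HasDerivAt (fun x => g (x * τ)) ((τ : ℂ) * g') x := by
    intro g g' x hg
    have h := HasDerivAt.scomp x hg ((hasDerivAt_id x).mul_const τ)
    simpa [Function.comp_def] using h
  have dx : ∀ x : ℝ, HasDerivAt (fun x : ℝ => (x : ℂ)) 1 x := fun x =>
    Complex.ofRealCLM.hasDerivAt (x := x)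
  set A : ℝ → ℂ := fun x => (τ : ℂ) ^ 2 * ((x : ℂ) ^ 2 / 2 * f1 (x * τ))
    - (τ : ℂ) * ((x : ℂ) * f (x * τ)) + P (x * τ) with hA
  set B : ℝ → ℂ := fun x => (τ : ℂ) ^ 2 * ((1 - (x : ℂ)) ^ 2 / 2 * f1 (x * τ))
    + (τ : ℂ) * ((1 - (x : ℂ)) * f (x * τ)) + P (x * τ) with hB
  have dA : ∀ x : ℝ, HasDerivAt A ((τ : ℂ) ^ 3 * ((x : ℂ) ^ 2 / 2 * f2 (x * τ))) x := by
    intro x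
    have := ((((((dx x).pow 2).div_const 2).mul (sc _ _ x (h2 (x * τ)))).const_mul ((τ : ℂ) ^ 2)).sub
      (((dx x).mul (sc _ _ x (h1 (x * τ)))).const_mul (τ : ℂ))).add (sc _ _ x (dP (x * τ)))
    refine this.congr_deriv ?_
    simp only [Pi.pow_apply]
    push_cast
    ring
  have dB : ∀ x : ℝ, HasDerivAt B ((τ : ℂ) ^ 3 * ((1 - (x : ℂ)) ^ 2 / 2 * f2 (x * τ))) x := by
    intro x
    have := (((((((dx x).const_sub 1).pow 2).div_const 2).mul
      (sc _ _ x (h2 (x * τ)))).const_mul ((τ : ℂ) ^ 2)).add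
      ((((dx x).const_sub 1).mul (sc _ _ x (h1 (x * τ)))).const_mul (τ : ℂ))).add
      (sc _ _ x (dP (x * τ)))
    refine this.congr_deriv ?_
    simp only [Pi.pow_apply]
    push_cast
    ring
  have iA : ∫ x in (0 : ℝ)..(1 / 2), (τ : ℂ) ^ 3 * ((x : ℂ) ^ 2 / 2 * f2 (x * τ)) =
      A (1 / 2) - A 0 :=
    intervalIntegral.integral_eq_sub_of_hasDerivAt (fun x _ => dA x)
      (Continuous.intervalIntegrable (by fun_prop) _ _)
  have iB : ∫ x in (1 / 2 : ℝ)..1, (τ : ℂ) ^ 3 * ((1 - (x : ℂ)) ^ 2 / 2 * f2 (x * τ)) =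
      B 1 - B (1 / 2) :=
    intervalIntegral.integral_eq_sub_of_hasDerivAt (fun x _ => dB x)
      (Continuous.intervalIntegrable (by fun_prop) _ _)
  have ck : Continuous fun θ : ℝ =>
      (τ : ℂ) ^ 3 * (((min (θ ^ 2) ((1 - θ) ^ 2) / 2 : ℝ) : ℂ) * f2 (θ * τ)) := by
    have : Continuous fun θ : ℝ => (min (θ ^ 2) ((1 - θ) ^ 2) / 2 : ℝ) := by fun_prop
    have := Complex.continuous_ofReal.comp this
    exact continuous_const.mul (this.mul (by fun_prop))
  rw [neg_mul, ← intervalIntegral.integral_const_mul,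
    ← intervalIntegral.integral_add_adjacent_intervals (b := 1 / 2)
      (ck.intervalIntegrable _ _) (ck.intervalIntegrable _ _)]
  have jA : ∫ θ in (0 : ℝ)..(1 / 2), (τ : ℂ) ^ 3 *
      (((min (θ ^ 2) ((1 - θ) ^ 2) / 2 : ℝ) : ℂ) * f2 (θ * τ)) = A (1 / 2) - A 0 := by
    rw [← iA]
    apply intervalIntegral.integral_congr
    intro θ hθ
    rw [Set.uIcc_of_le (by norm_num)] at hθ
    have : min (θ ^ 2) ((1 - θ) ^ 2) = θ ^ 2 := min_eq_left (by nlinarith [hθ.1, hθ.2])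
    simp only [this]
    push_cast
    ring
  have jB : ∫ θ in (1 / 2 : ℝ)..1, (τ : ℂ) ^ 3 *
      (((min (θ ^ 2) ((1 - θ) ^ 2) / 2 : ℝ) : ℂ) * f2 (θ * τ)) = B 1 - B (1 / 2) := by
    rw [← iB]
    apply intervalIntegral.integral_congr
    intro θ hθ
    rw [Set.uIcc_of_le (by norm_num)] at hθ
    have : min (θ ^ 2) ((1 - θ) ^ 2) = (1 - θ) ^ 2 := min_eq_right (by nlinarith [hθ.1, hθ.2])
    simp only [this]
    push_cast
    ring
  rw [jA, jB]
  have hP0 : P 0 = 0 := by simp [hP]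
  have e : (1 / 2 : ℝ) * τ = τ / 2 := by ring
  simp only [hA, hB, e, one_mul, zero_mul, hP0]
  change _ - P τ = _
  push_cast
  ring

lemma kernel_bound (g : ℝ → ℂ) (M : ℝ) (hM : 0 ≤ M) (h : ∀ t, ‖g t‖ ≤ M) (τ : ℝ) :
    ‖∫ θ in (0 : ℝ)..(1 : ℝ), ((min (θ ^ 2) ((1 - θ) ^ 2) / 2 : ℝ) : ℂ) * g (θ * τ)‖ ≤ M := by
  have := intervalIntegral.norm_integral_le_of_norm_le_const (a := 0) (b := 1) (C := M)
    (f := fun θ : ℝ => ((min (θ ^ 2) ((1 - θ) ^ 2) / 2 : ℝ) : ℂ) * g (θ * τ)) ?_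
  · simpa using this
  intro θ hθ
  rw [Set.uIoc_of_le (by norm_num)] at hθ
  rw [norm_mul, Complex.norm_real]
  have h0 : 0 ≤ min (θ ^ 2) ((1 - θ) ^ 2) := le_min (sq_nonneg _) (sq_nonneg _)
  have h1 : min (θ ^ 2) ((1 - θ) ^ 2) ≤ 1 :=
    (min_le_left _ _).trans (by nlinarith [hθ.1, hθ.2])
  rw [Real.norm_of_nonneg (by positivity)]
  calc _ ≤ 1 * M := by gcongr; linarith; exact h _
    _ = M := one_mul _

lemma Ft_good (a b : ℝ) (hab : a < b) (p : ℕ) (s : ℝ) (hs : 1 ≤ s) :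
    ∃ C : ℝ≥0∞, C ≠ ⊤ ∧ ∀ ψ : ℤ → ℂ, QQ a b (s + 1) (fun l => ‖ψ l‖ₑ) ≠ ⊤ →
      ∃ (f1 f2 : ℝ → ℤ → ℂ) (Z : ℤ → ℝ≥0∞),
        (∀ t l, HasDerivAt (fun t => Ft a b p t ψ l) (f1 t l) t) ∧
        (∀ t l, HasDerivAt (fun t => f1 t l) (f2 t l) t) ∧
        (∀ l, Continuous fun t => f2 t l) ∧
        (∀ t l, ‖f2 t l‖ₑ ≤ Z l) ∧
        QQ a b s Z ≤ C * QQ a b (s + 1) (fun l => ‖ψ l‖ₑ) ^ (p + 1) := by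
  obtain ⟨C, hC, H⟩ := Good.pow a b hab s hs (p + 1)
  refine ⟨1000 * (C * 8 ^ (p + 1)), ENNReal.mul_ne_top (by norm_num)
    (ENNReal.mul_ne_top hC (ENNReal.pow_ne_top (by norm_num))), ?_⟩
  intro ψ hψ
  obtain ⟨u1, u2, X, X1, X2, du, du1, cu, bu, bu1, bu2, qu, qu1, qu2⟩ :=
    H _ _ (ENNReal.mul_ne_top (by norm_num) hψ) (Good.wave a b s ψ)
  set S := QQ a b (s + 1) (fun l => ‖ψ l‖ₑ) with hS
  set K := C * (8 * S) ^ (p + 1) with hK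
  set u : ℝ → ℤ → ℂ := fun t => powC (reC (expJ a b t ψ)) (p + 1) with hu
  set z : ℤ → ℂ := fun l => Complex.I * ((-zeta a b l : ℝ) : ℂ) with hz
  set c : ℤ → ℂ := fun l => Complex.I / (zeta a b l : ℂ) with hc
  have e0 : ∀ t l, Ft a b p t ψ l = c l * (Complex.exp (z l * (t : ℂ)) * u t l) := by
    intro t l
    simp only [Ft, hc, hz, hu]
    rw [expJ, Fop, opJinv, Gop]
    have : Complex.I * ((-t : ℝ) : ℂ) * (zeta a b l : ℂ) =
      Complex.I * ((-zeta a b l : ℝ) : ℂ) * (t : ℂ) := by push_cast; ring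
    rw [this]
    ring
  have ze : ∀ l, ‖z l‖ₑ = zz a b l := by
    intro l
    simp only [hz]
    rw [enorm_mul, Complex.ofReal_neg, enorm_neg, zeta_enorm, ← ofReal_norm, Complex.norm_I]; simp
  have xe : ∀ (t : ℝ) l, ‖Complex.exp (z l * (t : ℂ))‖ₑ = 1 := fun t l => exp_enorm _ _
  have ce : ∀ l, ‖c l‖ₑ = (zz a b l)⁻¹ := by
    intro l
    have hpos : 0 < zeta a b l := by linarith [one_le_zeta a b l]
    simp only [hc, zz]
    rw [← ofReal_norm, norm_div, Complex.norm_I, Complex.norm_real,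
      Real.norm_of_nonneg hpos.le, one_div, ENNReal.ofReal_inv_of_pos hpos]
  have ccu : ∀ l, Continuous fun t => u t l := fun l =>
    continuous_iff_continuousAt.mpr fun t => (du t l).continuousAt
  have ccu1 : ∀ l, Continuous fun t => u1 t l := fun l =>
    continuous_iff_continuousAt.mpr fun t => (du1 t l).continuousAt
  have hzi : ∀ l, (zz a b l)⁻¹ * zz a b l = 1 := fun l =>
    ENNReal.inv_mul_cancel (zz_ne_zero a b l) (zz_ne_top a b l)
  refine ⟨fun t l => c l * (z l * Complex.exp (z l * (t : ℂ)) * u t l +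
      Complex.exp (z l * (t : ℂ)) * u1 t l),
    fun t l => c l * ((z l * (z l * Complex.exp (z l * (t : ℂ))) * u t l +
      z l * Complex.exp (z l * (t : ℂ)) * u1 t l) +
      (z l * Complex.exp (z l * (t : ℂ)) * u1 t l + Complex.exp (z l * (t : ℂ)) * u2 t l)),
    fun l => (zz a b l * X l + X1 l) + (X1 l + (zz a b l)⁻¹ * X2 l), ?_, ?_, ?_, ?_, ?_⟩
  · intro t l
    simp_rw [e0]
    exact (((exp_deriv (z l) t).mul (du t l)).const_mul (c l))
  · intro t l
    exact (((((exp_deriv (z l) t).const_mul (z l)).mul (du t l)).add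
      ((exp_deriv (z l) t).mul (du1 t l))).const_mul (c l))
  · intro l
    have := ccu l
    have := ccu1 l
    have := cu l
    fun_prop
  · intro t l
    rw [enorm_mul, ce]
    have hb : ‖(z l * (z l * Complex.exp (z l * (t : ℂ))) * u t l +
      z l * Complex.exp (z l * (t : ℂ)) * u1 t l) +
      (z l * Complex.exp (z l * (t : ℂ)) * u1 t l + Complex.exp (z l * (t : ℂ)) * u2 t l)‖ₑ ≤
      (zz a b l * (zz a b l * X l) + zz a b l * X1 l) + (zz a b l * X1 l + X2 l) := by
      refine (enorm_add_le _ _).trans (add_le_add ((enorm_add_le _ _).trans (add_le_add ?_ ?_))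
        ((enorm_add_le _ _).trans (add_le_add ?_ ?_)))
      · simp only [enorm_mul, xe, ze, mul_one, mul_assoc]
        rw [one_mul]; gcongr; exact bu t l
      · simp only [enorm_mul, xe, ze, mul_one]
        gcongr; exact bu1 t l
      · simp only [enorm_mul, xe, ze, mul_one]
        gcongr; exact bu1 t l
      · simp only [enorm_mul, xe, one_mul]
        exact bu2 t l
    calc _ ≤ (zz a b l)⁻¹ * ((zz a b l * (zz a b l * X l) + zz a b l * X1 l) +
          (zz a b l * X1 l + X2 l)) := by gcongr
      _ = (((zz a b l)⁻¹ * zz a b l) * (zz a b l * X l) + ((zz a b l)⁻¹ * zz a b l) * X1 l) +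
          (((zz a b l)⁻¹ * zz a b l) * X1 l + (zz a b l)⁻¹ * X2 l) := by ring
      _ = _ := by simp only [hzi, one_mul]
  · have q2 : QQ a b s (fun l => (zz a b l)⁻¹ * X2 l) ≤ K := by
      have e : s = (s - 1) + 1 := by ring
      rw [e, ← QQ_zz]
      refine le_trans (le_of_eq ?_) qu2
      congr 1
      funext l
      rw [← mul_assoc, mul_comm (zz a b l), hzi, one_mul]
    have q0 : QQ a b s (fun l => zz a b l * X l) ≤ K := by rw [QQ_zz]; exact qu
    calc _ ≤ 4 * (4 * (K + K) + 4 * (K + K)) :=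
        (QQ_add _ _ _ _ _).trans (by
          gcongr
          · exact (QQ_add _ _ _ _ _).trans (by gcongr)
          · exact (QQ_add _ _ _ _ _).trans (by gcongr))
      _ = 64 * K := by ring
      _ ≤ 1000 * K := by gcongr; norm_num
      _ = _ := by rw [hK, mul_pow]; ring

/-- Midpoint quadrature error
`r₁ = τ F_{τ/2}(ψ) − ∫₀^τ F_θ(ψ)dθ`: the Peano representation
`r₁ = −τ³∫₀¹ κ₂(θ) ∂²_ω F_ω(ψ)|_{ω=θτ} dθ` with
`κ₂(θ) = min{θ²,(1−θ)²}/2`, and the bound `‖r₁‖_s ≤ Cτ³‖ψ‖_{s+1}^{p+1}`. -/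
theorem midpoint_quadrature_error (a b : ℝ) (hab : a < b) (p : ℕ) (hp : 1 ≤ p)
    (s : ℝ) (hs : 1 ≤ s) :
    ∃ C > 0, ∀ (ψ : ℤ → ℂ), MemHs a b (s + 1) ψ → ∀ (τ : ℝ), 0 < τ →
      ∀ r₁ : ℤ → ℂ,
        (∀ l : ℤ, r₁ l = (τ : ℂ) * Ft a b p (τ / 2) ψ l
            - ∫ θ in (0 : ℝ)..τ, Ft a b p θ ψ l) →
        (∀ l : ℤ, r₁ l = -((τ : ℂ) ^ 3) *
            ∫ θ in (0 : ℝ)..(1 : ℝ),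
              ((min (θ ^ 2) ((1 - θ) ^ 2) / 2 : ℝ) : ℂ) * d2Ft a b p (θ * τ) ψ l) ∧
        sobNorm a b s r₁ ≤ C * τ ^ 3 * sobNorm a b (s + 1) ψ ^ (p + 1) := by
  obtain ⟨C, hC, H⟩ := Ft_good a b hab p s hs
  refine ⟨√C.toReal + 1, by positivity, ?_⟩
  intro ψ hψ τ hτ r₁ hr
  have hQ := QQ_memHs a b (s + 1) ψ hψ
  set S := sobNormSq a b (s + 1) ψ with hS
  have hS0 : 0 ≤ S := tsum_nonneg fun l => by positivity
  obtain ⟨f1, f2, Z, h1, h2, h3, h4, h5⟩ := H ψ (by rw [hQ]; exact ENNReal.ofReal_ne_top)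
  have hd1 : ∀ t l, dFt a b p t ψ l = f1 t l := fun t l => (h1 t l).deriv
  have hd2 : ∀ t l, d2Ft a b p t ψ l = f2 t l := by
    intro t l
    unfold d2Ft
    simp_rw [hd1]
    exact (h2 t l).deriv
  have hpe : ∀ l : ℤ, r₁ l = -((τ : ℂ) ^ 3) *
      ∫ θ in (0 : ℝ)..(1 : ℝ),
        ((min (θ ^ 2) ((1 - θ) ^ 2) / 2 : ℝ) : ℂ) * d2Ft a b p (θ * τ) ψ l := by
    intro l
    simp_rw [hr, hd2]
    exact peano (fun t => Ft a b p t ψ l) (fun t => f1 t l) (fun t => f2 t l)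
      (fun t => h1 t l) (fun t => h2 t l) (h3 l) τ
  refine ⟨hpe, ?_⟩
  rw [hQ] at h5
  have hZt : QQ a b s Z ≠ ⊤ := ne_top_of_le_ne_top
    (ENNReal.mul_ne_top hC (ENNReal.pow_ne_top ENNReal.ofReal_ne_top)) h5
  have hZ := QQ_ne_top a b s (by linarith) hZt
  have hrb : ∀ l, ‖r₁ l‖ₑ ≤ ENNReal.ofReal (τ ^ 3) * Z l := by
    intro l
    have hk := kernel_bound (fun t => f2 t l) (Z l).toReal ENNReal.toReal_nonneg
      (fun t => by
        rw [← toReal_enorm]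
        exact ENNReal.toReal_mono (hZ l) (h4 t l)) τ
    rw [hpe l, enorm_mul, enorm_neg]
    simp_rw [hd2]
    refine mul_le_mul' (le_of_eq ?_) ?_
    · rw [← ofReal_norm, norm_pow, Complex.norm_real, Real.norm_of_nonneg hτ.le]
    · rw [← ofReal_norm]
      exact ENNReal.ofReal_le_of_le_toReal hk
  have hfin : sobNormSq a b s r₁ ≤ (τ ^ 3) ^ 2 * (C.toReal * S ^ (p + 1)) := by
    apply sobNormSq_le
    · positivity
    refine (QQ_mono_fun a b s hrb).trans ?_
    rw [QQ_smul, ENNReal.ofReal_mul (by positivity), ENNReal.ofReal_mul (by positivity),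
      ENNReal.ofReal_pow (p := τ ^ 3) (by positivity), ENNReal.ofReal_pow hS0, ENNReal.ofReal_toReal hC]
    gcongr
  unfold sobNorm
  have hs2 : (√S ^ (p + 1)) ^ 2 = S ^ (p + 1) := by
    rw [← pow_mul, mul_comm, pow_mul, Real.sq_sqrt hS0]
  have hc2 : √C.toReal ^ 2 = C.toReal := Real.sq_sqrt ENNReal.toReal_nonneg
  calc √(sobNormSq a b s r₁) ≤ √((√C.toReal * τ ^ 3 * √S ^ (p + 1)) ^ 2) := by
        apply Real.sqrt_le_sqrt
        rw [mul_pow, mul_pow, hs2, hc2]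
        linarith
    _ = √C.toReal * τ ^ 3 * √S ^ (p + 1) := Real.sqrt_sq (by positivity)
    _ ≤ (√C.toReal + 1) * τ ^ 3 * √S ^ (p + 1) := by
        gcongr
        linarith

end NKGE
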